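/- For every integer k ≥ 1 and every minimiser (a₁*, a₂*, a₃*) for λ_k, one has a₃* ≤ 319. -/

import Mathlib

/-- The Dirichlet eigenvalue counting function of the cuboid `(0,a₁)×(0,a₂)×(0,a₃)`:
the number of triples `(i₁,i₂,i₃) ∈ ℤ³` with `i₁,i₂,i₃ ≥ 1` and
`π²(i₁²/a₁² + i₂²/a₂² + i₃²/a₃²) ≤ lam`. -/
noncomputable def cuboidCount (a₁ a₂ a₃ lam : ℝ) : ℕ :=
  Nat.card {p : ℤ × ℤ × ℤ //
    1 ≤ p.1 ∧ 1 ≤ p.2.1 ∧ 1 ≤ p.2.2 ∧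
    Real.pi ^ 2 * ((p.1 : ℝ) ^ 2 / a₁ ^ 2 + (p.2.1 : ℝ) ^ 2 / a₂ ^ 2
      + (p.2.2 : ℝ) ^ 2 / a₃ ^ 2) ≤ lam}

/-- `cuboidEig a₁ a₂ a₃ k` is the `k`-th smallest Dirichlet eigenvalue (counted with
multiplicity) of the cuboid `(0,a₁)×(0,a₂)×(0,a₃)`, expressed as the least `lam` whose
eigenvalue count is at least `k`. -/
noncomputable def cuboidEig (a₁ a₂ a₃ : ℝ) (k : ℕ) : ℝ :=
  sInf {lam : ℝ | k ≤ cuboidCount a₁ a₂ a₃ lam}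

/-- `(a₁,a₂,a₃)` is a minimiser for `λ_k` among cuboids of unit measure. -/
noncomputable def IsMinimiser (k : ℕ) (a₁ a₂ a₃ : ℝ) : Prop :=
  0 < a₁ ∧ a₁ ≤ a₂ ∧ a₂ ≤ a₃ ∧ a₁ * a₂ * a₃ = 1 ∧
    ∀ b₁ b₂ b₃ : ℝ, 0 < b₁ → b₁ ≤ b₂ → b₂ ≤ b₃ → b₁ * b₂ * b₃ = 1 →
      cuboidEig a₁ a₂ a₃ k ≤ cuboidEig b₁ b₂ b₃ k

open Finset in
/-- The set of admissible triples is the image of an explicit finite set. -/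
lemma cub_set_eq (a b c x : ℝ) (ha : 0 < a) (hb : 0 < b) (hc : 0 < c) (hx : 0 ≤ x) :
    {p : ℤ × ℤ × ℤ | 1 ≤ p.1 ∧ 1 ≤ p.2.1 ∧ 1 ≤ p.2.2 ∧
    Real.pi ^ 2 * ((p.1 : ℝ) ^ 2 / a ^ 2 + (p.2.1 : ℝ) ^ 2 / b ^ 2
      + (p.2.2 : ℝ) ^ 2 / c ^ 2) ≤ Real.pi ^ 2 * x ^ 2} =
    (fun q : (Σ _ : ℕ × ℕ, ℕ) => ((q.1.1 : ℤ), (q.1.2 : ℤ), (q.2 : ℤ))) ''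
      (((Icc 1 ⌊a * x⌋₊ ×ˢ Icc 1 ⌊b * x⌋₊).sigma (fun p : ℕ × ℕ =>
        Icc 1 ⌊c * Real.sqrt (x ^ 2 - (p.1 : ℝ) ^ 2 / a ^ 2 - (p.2 : ℝ) ^ 2 / b ^ 2)⌋₊) :
        Finset (Σ _ : ℕ × ℕ, ℕ)) : Set (Σ _ : ℕ × ℕ, ℕ)) := by
  have hpi : 0 < Real.pi ^ 2 := by positivity
  have key : ∀ k : ℕ, 1 ≤ k → ∀ A : ℝ, (k ≤ ⌊c * Real.sqrt A⌋₊ ↔ (k : ℝ) ^ 2 / c ^ 2 ≤ A) := by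
    intro k hk A
    have hk0 : (0 : ℝ) < k := by exact_mod_cast hk
    rw [Nat.le_floor_iff (by positivity), ← div_le_iff₀' hc, Real.le_sqrt' (by positivity), div_pow]
  ext ⟨i, j, k⟩
  simp only [Set.mem_ofPred_eq, Set.mem_image, SetLike.mem_coe, Finset.mem_sigma, Finset.mem_product,
    Finset.mem_Icc, Prod.mk.injEq, mul_le_mul_iff_right₀ hpi]
  constructor
  · rintro ⟨hi, hj, hk, h⟩
    lift i to ℕ using by omega
    lift j to ℕ using by omega
    lift k to ℕ using by omega
    push_cast at h hi hj hk
    norm_cast at hi hj hk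
    refine ⟨⟨(i, j), k⟩, ⟨⟨⟨hi, ?_⟩, hj, ?_⟩, hk, ?_⟩, rfl, rfl, rfl⟩
    · rw [Nat.le_floor_iff (by positivity), ← div_le_iff₀' ha]
      apply le_of_sq_le_sq _ hx
      rw [div_pow]
      have : 0 ≤ (j : ℝ) ^ 2 / b ^ 2 := by positivity
      have : 0 ≤ (k : ℝ) ^ 2 / c ^ 2 := by positivity
      linarith
    · rw [Nat.le_floor_iff (by positivity), ← div_le_iff₀' hb]
      apply le_of_sq_le_sq _ hx
      rw [div_pow]
      have : 0 ≤ (i : ℝ) ^ 2 / a ^ 2 := by positivity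
      have : 0 ≤ (k : ℝ) ^ 2 / c ^ 2 := by positivity
      linarith
    · rw [key k hk]; linarith
  · rintro ⟨⟨⟨i', j'⟩, k'⟩, ⟨⟨⟨hi, hi2⟩, hj, hj2⟩, hk, hk2⟩, rfl, rfl, rfl⟩
    rw [key k' hk] at hk2
    simp only at hi hj hk hk2 ⊢
    refine ⟨by exact_mod_cast hi, by exact_mod_cast hj, by exact_mod_cast hk, ?_⟩
    push_cast
    linarith

open Finset in
lemma cub_count_eq (a b c x : ℝ) (ha : 0 < a) (hb : 0 < b) (hc : 0 < c) (hx : 0 ≤ x) :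
    cuboidCount a b c (Real.pi ^ 2 * x ^ 2) =
    ∑ i ∈ Icc 1 ⌊a * x⌋₊, ∑ j ∈ Icc 1 ⌊b * x⌋₊,
      ⌊c * Real.sqrt (x ^ 2 - (i : ℝ) ^ 2 / a ^ 2 - (j : ℝ) ^ 2 / b ^ 2)⌋₊ := by
  have h := cub_set_eq a b c x ha hb hc hx
  have h2 : cuboidCount a b c (Real.pi ^ 2 * x ^ 2) = Set.ncard {p : ℤ × ℤ × ℤ | 1 ≤ p.1 ∧ 1 ≤ p.2.1 ∧ 1 ≤ p.2.2 ∧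
    Real.pi ^ 2 * ((p.1 : ℝ) ^ 2 / a ^ 2 + (p.2.1 : ℝ) ^ 2 / b ^ 2
      + (p.2.2 : ℝ) ^ 2 / c ^ 2) ≤ Real.pi ^ 2 * x ^ 2} := rfl
  rw [h2, h, Set.ncard_image_of_injective, Set.ncard_coe_finset, Finset.card_sigma,
    Finset.sum_product]
  · simp
  · rintro ⟨⟨i, j⟩, k⟩ ⟨⟨i', j'⟩, k'⟩ h
    simp only [Prod.mk.injEq, Nat.cast_inj] at h
    obtain ⟨rfl, rfl, rfl⟩ := h
    rfl

lemma cub_finite (a b c lam : ℝ) (ha : 0 < a) (hb : 0 < b) (hc : 0 < c) :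
    {p : ℤ × ℤ × ℤ | 1 ≤ p.1 ∧ 1 ≤ p.2.1 ∧ 1 ≤ p.2.2 ∧
    Real.pi ^ 2 * ((p.1 : ℝ) ^ 2 / a ^ 2 + (p.2.1 : ℝ) ^ 2 / b ^ 2
      + (p.2.2 : ℝ) ^ 2 / c ^ 2) ≤ lam}.Finite := by
  have hpi : 0 < Real.pi ^ 2 := by positivity
  have h := cub_set_eq a b c (Real.sqrt (|lam| / Real.pi ^ 2)) ha hb hc (Real.sqrt_nonneg _)
  rw [Real.sq_sqrt (by positivity), mul_div_cancel₀ _ hpi.ne'] at h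
  have hf := (Finset.finite_toSet _).image _ |>.subset h.subset
  refine hf.subset ?_
  rintro p ⟨h1, h2, h3, h4⟩
  exact ⟨h1, h2, h3, h4.trans (le_abs_self _)⟩

lemma cub_mono (a b c l m : ℝ) (ha : 0 < a) (hb : 0 < b) (hc : 0 < c) (h : l ≤ m) :
    cuboidCount a b c l ≤ cuboidCount a b c m := by
  refine Set.ncard_le_ncard (s := {p : ℤ × ℤ × ℤ | 1 ≤ p.1 ∧ 1 ≤ p.2.1 ∧ 1 ≤ p.2.2 ∧
    Real.pi ^ 2 * ((p.1 : ℝ) ^ 2 / a ^ 2 + (p.2.1 : ℝ) ^ 2 / b ^ 2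
      + (p.2.2 : ℝ) ^ 2 / c ^ 2) ≤ l}) ?_ (cub_finite a b c m ha hb hc)
  rintro p ⟨h1, h2, h3, h4⟩
  exact ⟨h1, h2, h3, h4.trans h⟩

lemma cub_lower (a b c lam : ℝ) (ha : 0 < a) (h : 1 ≤ cuboidCount a b c lam) :
    Real.pi ^ 2 * (1 / a) ^ 2 ≤ lam := by
  have hne : cuboidCount a b c lam ≠ 0 := by omega
  unfold cuboidCount at hne
  have := (Nat.card_ne_zero.mp hne).1
  obtain ⟨p, h1, h2, h3, h4⟩ := this
  refine le_trans ?_ h4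
  have hp : (1 : ℝ) ≤ p.1 := by exact_mod_cast h1
  have h5 : (1 / a) ^ 2 ≤ (p.1 : ℝ) ^ 2 / a ^ 2 := by
    rw [div_pow]
    gcongr
  have : 0 ≤ (p.2.1 : ℝ) ^ 2 / b ^ 2 := by positivity
  have : 0 ≤ (p.2.2 : ℝ) ^ 2 / c ^ 2 := by positivity
  gcongr
  linarith

lemma cub_nonempty (a b c : ℝ) (k : ℕ) (ha : 0 < a) (hb : 0 < b) (hc : 0 < c) :
    ∃ lam, k ≤ cuboidCount a b c lam := by
  refine ⟨Real.pi ^ 2 * (1 / a ^ 2 + 1 / b ^ 2 + (k : ℝ) ^ 2 / c ^ 2), ?_⟩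
  have hinj : Function.Injective (fun q : ℕ => ((1 : ℤ), (1 : ℤ), (q : ℤ))) := by
    intro q r h
    simpa using h
  have : ((fun q : ℕ => ((1 : ℤ), (1 : ℤ), (q : ℤ))) '' (Finset.Icc 1 k : Finset ℕ)).ncard = k := by
    rw [Set.ncard_image_of_injective _ hinj, Set.ncard_coe_finset]
    simp
  rw [← this]
  refine Set.ncard_le_ncard ?_ (cub_finite a b c _ ha hb hc)
  rw [this]
  rintro _ ⟨q, hq, rfl⟩
  simp only [Finset.coe_Icc, Set.mem_Icc] at hq
  refine ⟨le_rfl, le_rfl, by simpa using hq.1, ?_⟩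
  have : (q : ℝ) ≤ k := by exact_mod_cast hq.2
  push_cast
  simp only [one_pow]
  gcongr

/-- Area of the quarter disc. -/
noncomputable def quarterI : ℝ := ∫ u in (0 : ℝ)..1, Real.sqrt (1 - u ^ 2)

lemma sq_cont : Continuous (fun u : ℝ => Real.sqrt (1 - u ^ 2)) := by fun_prop

lemma quarterI_ge : 1 / 2 ≤ quarterI := by
  have h1 : ∫ u in (0 : ℝ)..1, (1 - u) = 1 / 2 := by
    rw [intervalIntegral.integral_sub (by simp) (by simp)]
    simp
    norm_num
  rw [← h1]
  apply intervalIntegral.integral_mono_on (by norm_num)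
  · exact (by fun_prop : Continuous (fun u : ℝ => 1 - u)).intervalIntegrable _ _
  · exact sq_cont.intervalIntegrable _ _
  · intro u hu
    apply Real.le_sqrt_of_sq_le
    nlinarith [hu.1, hu.2]

lemma J_eq (y : ℝ) (hy : 1 ≤ y) : ∫ u in (0 : ℝ)..y, Real.sqrt (1 - u ^ 2) = quarterI := by
  rw [← intervalIntegral.integral_add_adjacent_intervals
    (sq_cont.intervalIntegrable 0 1) (sq_cont.intervalIntegrable 1 y)]
  have : ∫ u in (1 : ℝ)..y, Real.sqrt (1 - u ^ 2) = ∫ u in (1 : ℝ)..y, (0 : ℝ) := by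
    apply intervalIntegral.integral_congr
    intro u hu
    rw [Set.uIcc_of_le hy] at hu
    apply Real.sqrt_eq_zero_of_nonpos
    nlinarith [hu.1]
  rw [this]
  simp [quarterI]

lemma J_le (y : ℝ) (hy : 0 ≤ y) : ∫ u in (0 : ℝ)..y, Real.sqrt (1 - u ^ 2) ≤ quarterI := by
  rw [← J_eq (max y 1) (le_max_right _ _)]
  apply intervalIntegral.integral_mono_interval le_rfl hy (le_max_left _ _)
  · exact Filter.Eventually.of_forall fun u => Real.sqrt_nonneg _
  · exact sq_cont.intervalIntegrable _ _

lemma int_scale (s a y : ℝ) (hs : 0 < s) (ha : 0 < a) :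
    ∫ t in (0 : ℝ)..y, Real.sqrt (s ^ 2 - t ^ 2 / a ^ 2) =
      a * s ^ 2 * ∫ u in (0 : ℝ)..(y / (a * s)), Real.sqrt (1 - u ^ 2) := by
  have h := intervalIntegral.integral_comp_div (a := 0) (b := y)
    (fun u : ℝ => Real.sqrt (1 - u ^ 2)) (c := a * s) (by positivity)
  rw [zero_div, smul_eq_mul] at h
  have h2 : ∀ t : ℝ, Real.sqrt (s ^ 2 - t ^ 2 / a ^ 2) = s * Real.sqrt (1 - (t / (a * s)) ^ 2) := by
    intro t
    have : s ^ 2 - t ^ 2 / a ^ 2 = s ^ 2 * (1 - (t / (a * s)) ^ 2) := by field_simp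
    rw [this, Real.sqrt_mul (by positivity), Real.sqrt_sq hs.le]
  simp_rw [h2]
  rw [intervalIntegral.integral_const_mul, h]
  ring

lemma anti_sqrt (s a y : ℝ) :
    AntitoneOn (fun t : ℝ => Real.sqrt (s ^ 2 - t ^ 2 / a ^ 2)) (Set.Icc 0 y) := by
  intro t ht r hr h
  have := ht.1
  dsimp only
  gcongr

lemma sum_Icc_eq (f : ℕ → ℝ) (M : ℕ) :
    ∑ j ∈ Finset.Icc 1 M, f j = ∑ j ∈ Finset.range M, f (j + 1) := by
  rw [Finset.range_eq_Ico, Finset.sum_Ico_add' f 0 M 1]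
  rfl

lemma sum_upper (s a : ℝ) (hs : 0 ≤ s) (ha : 0 < a) (M : ℕ) :
    ∑ j ∈ Finset.Icc 1 M, Real.sqrt (s ^ 2 - (j : ℝ) ^ 2 / a ^ 2) ≤ a * s ^ 2 * quarterI := by
  rcases hs.eq_or_lt with rfl | hs
  · have : ∀ j ∈ Finset.Icc 1 M, Real.sqrt ((0 : ℝ) ^ 2 - (j : ℝ) ^ 2 / a ^ 2) = 0 := by
      intro j _
      apply Real.sqrt_eq_zero_of_nonpos
      have : 0 ≤ (j : ℝ) ^ 2 / a ^ 2 := by positivity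
      linarith
    rw [Finset.sum_congr rfl this]
    simp
  · have h := AntitoneOn.sum_le_integral (x₀ := 0) (a := M)
      (f := fun t : ℝ => Real.sqrt (s ^ 2 - t ^ 2 / a ^ 2)) (anti_sqrt s a _)
    simp only [zero_add] at h
    rw [sum_Icc_eq (fun j => Real.sqrt (s ^ 2 - (j : ℝ) ^ 2 / a ^ 2))]
    refine h.trans ?_
    rw [int_scale s a _ hs ha]
    gcongr
    exact J_le _ (by positivity)

lemma sum_lower (s : ℝ) (hs : 0 ≤ s) (M : ℕ) (hM : s ≤ M + 1) :
    s ^ 2 * quarterI - s ≤ ∑ j ∈ Finset.Icc 1 M, Real.sqrt (s ^ 2 - (j : ℝ) ^ 2 / 1 ^ 2) := by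
  rcases hs.eq_or_lt with rfl | hs
  · have : 0 ≤ ∑ j ∈ Finset.Icc 1 M, Real.sqrt ((0 : ℝ) ^ 2 - (j : ℝ) ^ 2 / 1 ^ 2) :=
      Finset.sum_nonneg fun _ _ => Real.sqrt_nonneg _
    linarith
  · have h := AntitoneOn.integral_le_sum (x₀ := 0) (a := M + 1)
      (f := fun t : ℝ => Real.sqrt (s ^ 2 - t ^ 2 / 1 ^ 2)) (anti_sqrt s 1 _)
    rw [Finset.sum_range_succ', zero_add, int_scale s 1 _ hs one_pos, J_eq] at h
    · rw [sum_Icc_eq (fun j => Real.sqrt (s ^ 2 - (j : ℝ) ^ 2 / 1 ^ 2))]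
      simp only [zero_add, Nat.cast_zero, one_mul] at h
      have h0 : Real.sqrt (s ^ 2 - (0 : ℝ) ^ 2 / 1 ^ 2) = s := by
        simp [Real.sqrt_sq hs.le]
      rw [h0] at h
      linarith
    · rw [le_div_iff₀ (by positivity)]
      push_cast
      linarith

lemma sum_sq (R : ℝ) (n : ℕ) : ∑ i ∈ Finset.Icc 1 n, (R ^ 2 - (i : ℝ) ^ 2) =
    R ^ 2 * n - n * (n + 1) * (2 * n + 1) / 6 := by
  rw [sum_Icc_eq (fun i => R ^ 2 - (i : ℝ) ^ 2)]
  induction n with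
  | zero => simp
  | succ n ih =>
    rw [Finset.sum_range_succ, ih]
    push_cast
    ring

lemma poly_upper (R : ℝ) (hR : 1 ≤ R) : ∑ i ∈ Finset.Icc 1 ⌊R⌋₊, (R ^ 2 - (i : ℝ) ^ 2) ≤
    2 / 3 * R ^ 3 - 1 / 3 * R ^ 2 := by
  rw [sum_sq]
  have h1 : (1 : ℝ) ≤ ⌊R⌋₊ := by exact_mod_cast (Nat.one_le_floor_iff R).mpr hR
  have h2 := Nat.floor_le (zero_le_one.trans hR)
  generalize (⌊R⌋₊ : ℝ) = n at *
  obtain ⟨d, rfl⟩ : ∃ d, R = n + d := ⟨R - n, by ring⟩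
  have hd : 0 ≤ d := by linarith
  obtain ⟨m, rfl⟩ : ∃ m, n = m + 1 := ⟨n - 1, by ring⟩
  have hm : 0 ≤ m := by linarith
  have e1 : 0 ≤ d ^ 3 := by positivity
  have e2 : 0 ≤ m * ((d - 1 / 3) ^ 2) := by positivity
  nlinarith [sq_nonneg (d - 1 / 2), mul_nonneg hm hm]

lemma poly_lower (x : ℝ) (hx : 0 ≤ x) : 2 / 3 * x ^ 3 - x ^ 2 ≤
    ∑ i ∈ Finset.Icc 1 ⌊x⌋₊, (x ^ 2 - (i : ℝ) ^ 2) := by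
  rw [sum_sq]
  have h1 : (0 : ℝ) ≤ ⌊x⌋₊ := by positivity
  have h0 : (⌊x⌋₊ : ℝ) ≤ (⌊x⌋₊ : ℝ) ^ 2 := by exact_mod_cast Nat.le_self_pow two_ne_zero _
  have h2 := Nat.floor_le hx
  have h3 := (Nat.lt_floor_add_one x).le
  generalize (⌊x⌋₊ : ℝ) = n at *
  obtain ⟨d, rfl⟩ : ∃ d, x = n + d := ⟨x - n, by ring⟩
  have hd : 0 ≤ d := by linarith
  have hd1 : 0 ≤ 1 - d := by linarith
  have e1 : 0 ≤ d ^ 2 * (1 - d) := by positivity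
  have e2 : 0 ≤ n * (d * (1 - d)) := by positivity
  nlinarith [mul_nonneg h1 h1, mul_nonneg h1 hd, sq_nonneg d]

lemma count_upper (a b c x : ℝ) (ha : 0 < a) (hb : 0 < b) (hc : 0 < c) (habc : a * b * c = 1)
    (hx : 1 ≤ a * x) :
    (cuboidCount a b c (Real.pi ^ 2 * x ^ 2) : ℝ) ≤
      quarterI * (2 / 3 * x ^ 3 - 1 / 3 * x ^ 2 / a) := by
  have hx0 : 0 < x := by
    by_contra! h
    nlinarith
  have hI : 0 ≤ quarterI := by linarith [quarterI_ge]
  rw [cub_count_eq a b c x ha hb hc hx0.le]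
  push_cast
  have step : ∀ i ∈ Finset.Icc 1 ⌊a * x⌋₊, ∑ j ∈ Finset.Icc 1 ⌊b * x⌋₊,
      (⌊c * Real.sqrt (x ^ 2 - (i : ℝ) ^ 2 / a ^ 2 - (j : ℝ) ^ 2 / b ^ 2)⌋₊ : ℝ) ≤
      c * b * quarterI / a ^ 2 * ((a * x) ^ 2 - (i : ℝ) ^ 2) := by
    intro i hi
    have hi2 : (i : ℝ) ≤ a * x :=
      (Nat.cast_le.mpr (Finset.mem_Icc.mp hi).2).trans (Nat.floor_le (by positivity))
    have hnn : 0 ≤ x ^ 2 - (i : ℝ) ^ 2 / a ^ 2 := by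
      rw [sub_nonneg, div_le_iff₀ (by positivity), ← mul_pow, mul_comm x a]
      gcongr
    have h := sum_upper (Real.sqrt (x ^ 2 - (i : ℝ) ^ 2 / a ^ 2)) b (Real.sqrt_nonneg _) hb ⌊b * x⌋₊
    rw [Real.sq_sqrt hnn] at h
    calc _ ≤ ∑ j ∈ Finset.Icc 1 ⌊b * x⌋₊,
          c * Real.sqrt (x ^ 2 - (i : ℝ) ^ 2 / a ^ 2 - (j : ℝ) ^ 2 / b ^ 2) :=
          Finset.sum_le_sum fun j _ => Nat.floor_le (by positivity)
      _ ≤ c * (b * (x ^ 2 - (i : ℝ) ^ 2 / a ^ 2) * quarterI) := by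
          rw [← Finset.mul_sum]
          gcongr
      _ = _ := by field_simp
  refine (Finset.sum_le_sum step).trans ?_
  rw [← Finset.mul_sum]
  have := poly_upper (a * x) hx
  calc _ ≤ c * b * quarterI / a ^ 2 * (2 / 3 * (a * x) ^ 3 - 1 / 3 * (a * x) ^ 2) := by gcongr
    _ = (a * b * c) * (quarterI * (2 / 3 * x ^ 3 - 1 / 3 * x ^ 2 / a)) := by field_simp
    _ = _ := by rw [habc, one_mul]

lemma count_lower (x : ℝ) (hx : 0 ≤ x) :
    quarterI * (2 / 3 * x ^ 3 - x ^ 2) - 2 * x ^ 2 ≤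
    (cuboidCount 1 1 1 (Real.pi ^ 2 * x ^ 2) : ℝ) := by
  have hI : 0 ≤ quarterI := by linarith [quarterI_ge]
  rw [cub_count_eq 1 1 1 x one_pos one_pos one_pos hx]
  push_cast
  simp only [one_mul]
  have hfl : (⌊x⌋₊ : ℝ) ≤ x := Nat.floor_le hx
  have step : ∀ i ∈ Finset.Icc 1 ⌊x⌋₊, quarterI * (x ^ 2 - (i : ℝ) ^ 2) - 2 * x ≤
      ∑ j ∈ Finset.Icc 1 ⌊x⌋₊,
      (⌊Real.sqrt (x ^ 2 - (i : ℝ) ^ 2 / 1 ^ 2 - (j : ℝ) ^ 2 / 1 ^ 2)⌋₊ : ℝ) := by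
    intro i hi
    have hi2 : (i : ℝ) ≤ x := (Nat.cast_le.mpr (Finset.mem_Icc.mp hi).2).trans hfl
    have hnn : 0 ≤ x ^ 2 - (i : ℝ) ^ 2 / 1 ^ 2 := by
      rw [one_pow, div_one, sub_nonneg]
      gcongr
    have hs : Real.sqrt (x ^ 2 - (i : ℝ) ^ 2 / 1 ^ 2) ≤ x := by
      rw [Real.sqrt_le_left hx]
      have : 0 ≤ (i : ℝ) ^ 2 / 1 ^ 2 := by positivity
      linarith
    have h := sum_lower (Real.sqrt (x ^ 2 - (i : ℝ) ^ 2 / 1 ^ 2)) (Real.sqrt_nonneg _) ⌊x⌋₊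
      (hs.trans (Nat.lt_floor_add_one x).le)
    rw [Real.sq_sqrt hnn] at h
    have h3 : ∑ j ∈ Finset.Icc 1 ⌊x⌋₊,
          (Real.sqrt (x ^ 2 - (i : ℝ) ^ 2 / 1 ^ 2 - (j : ℝ) ^ 2 / 1 ^ 2) - 1) ≤
          ∑ j ∈ Finset.Icc 1 ⌊x⌋₊,
      (⌊Real.sqrt (x ^ 2 - (i : ℝ) ^ 2 / 1 ^ 2 - (j : ℝ) ^ 2 / 1 ^ 2)⌋₊ : ℝ) :=
          Finset.sum_le_sum fun j _ => (Nat.sub_one_lt_floor _).le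
    refine le_trans ?_ h3
    rw [Finset.sum_sub_distrib]
    simp only [Finset.sum_const, Nat.card_Icc, add_tsub_cancel_right, nsmul_eq_mul, mul_one]
    rw [one_pow, div_one] at *
    linarith
  refine le_trans ?_ (Finset.sum_le_sum step)
  rw [Finset.sum_sub_distrib, ← Finset.mul_sum]
  simp only [Finset.sum_const, Nat.card_Icc, add_tsub_cancel_right, nsmul_eq_mul]
  have h1 := mul_le_mul_of_nonneg_left (poly_lower x hx) hI
  nlinarith

/-- For every `k ≥ 1`, any minimiser `(a₁*,a₂*,a₃*)` for `λ_k` satisfies `a₃* ≤ 319`. -/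
theorem minimiser_longest_side_le_319 (k : ℕ) (hk : 1 ≤ k) (a₁ a₂ a₃ : ℝ)
    (hmin : IsMinimiser k a₁ a₂ a₃) : a₃ ≤ 319 := by
  obtain ⟨ha, h12, h23, hprod, hm⟩ := hmin
  have hb : 0 < a₂ := by linarith
  have hc : 0 < a₃ := by linarith
  have hcube := hm 1 1 1 one_pos le_rfl le_rfl (by norm_num)
  by_contra! hlong
  have hpi : 0 < Real.pi ^ 2 := by positivity
  -- short side
  have hshort : 17 * a₁ < 1 := by
    by_contra! h
    have h1 : a₁ * a₁ ≤ a₁ * a₂ := by gcongr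
    have h2 : a₁ * a₁ * a₃ ≤ a₁ * a₂ * a₃ := by gcongr
    nlinarith
  set L := cuboidEig a₁ a₂ a₃ k with hL
  have hLge : Real.pi ^ 2 * (1 / a₁) ^ 2 ≤ L :=
    le_csInf (cub_nonempty a₁ a₂ a₃ k ha hb hc)
      fun lam hlam => cub_lower a₁ a₂ a₃ lam ha (hk.trans hlam)
  have hL0 : 0 ≤ L := le_trans (by positivity) hLge
  obtain ⟨x, hx0, hxL⟩ : ∃ x, 0 ≤ x ∧ L = Real.pi ^ 2 * x ^ 2 := by
    refine ⟨Real.sqrt (L / Real.pi ^ 2), Real.sqrt_nonneg _, ?_⟩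
    rw [Real.sq_sqrt (by positivity), mul_div_cancel₀ _ hpi.ne']
  rw [hxL, mul_le_mul_iff_right₀ hpi] at hLge
  have hxa : 1 / a₁ ≤ x := le_of_sq_le_sq hLge hx0
  have hxa' : 1 ≤ a₁ * x := by rwa [div_le_iff₀' ha] at hxa
  have hxpos : 0 < x := lt_of_lt_of_le (by positivity) hxa
  have main : ∀ e : ℝ, 0 < e → e < x →
      quarterI * (2 / 3 * (x - e) ^ 3 - (x - e) ^ 2) - 2 * (x - e) ^ 2 ≤
      quarterI * (2 / 3 * (x + e) ^ 3 - 1 / 3 * (x + e) ^ 2 / a₁) := by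
    intro e he hex
    have hup := count_upper a₁ a₂ a₃ (x + e) ha hb hc hprod (by nlinarith)
    have hlo := count_lower (x - e) (by linarith)
    refine hlo.trans (le_trans ?_ hup)
    have h1 : k ≤ cuboidCount a₁ a₂ a₃ (Real.pi ^ 2 * (x + e) ^ 2) := by
      have hlt : L < Real.pi ^ 2 * (x + e) ^ 2 := by
        rw [hxL]
        gcongr
        linarith
      obtain ⟨l, hl, hl2⟩ := exists_lt_of_csInf_lt (cub_nonempty a₁ a₂ a₃ k ha hb hc) hlt
      exact le_trans hl (cub_mono _ _ _ _ _ ha hb hc hl2.le)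
    have h2 : cuboidCount 1 1 1 (Real.pi ^ 2 * (x - e) ^ 2) < k := by
      by_contra! h
      have hle : cuboidEig 1 1 1 k ≤ Real.pi ^ 2 * (x - e) ^ 2 := by
        refine csInf_le ⟨Real.pi ^ 2 * (1 / 1) ^ 2, ?_⟩ h
        exact fun lam hlam => cub_lower 1 1 1 lam one_pos (hk.trans hlam)
      have hlt : Real.pi ^ 2 * (x - e) ^ 2 < L := by
        rw [hxL]
        have : 0 ≤ x - e := by linarith
        gcongr
        linarith
      linarith
    exact_mod_cast h2.le.trans h1
  have lim : quarterI * (2 / 3 * x ^ 3 - x ^ 2) - 2 * x ^ 2 ≤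
      quarterI * (2 / 3 * x ^ 3 - 1 / 3 * x ^ 2 / a₁) := by
    have c1 : Filter.Tendsto (fun e : ℝ =>
        quarterI * (2 / 3 * (x - e) ^ 3 - (x - e) ^ 2) - 2 * (x - e) ^ 2)
        (nhdsWithin 0 (Set.Ioi 0)) (nhds (quarterI * (2 / 3 * x ^ 3 - x ^ 2) - 2 * x ^ 2)) := by
      have : Continuous (fun e : ℝ =>
        quarterI * (2 / 3 * (x - e) ^ 3 - (x - e) ^ 2) - 2 * (x - e) ^ 2) := by fun_prop
      have h := this.tendsto 0
      simp only [sub_zero] at h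
      exact h.mono_left nhdsWithin_le_nhds
    have c2 : Filter.Tendsto (fun e : ℝ =>
        quarterI * (2 / 3 * (x + e) ^ 3 - 1 / 3 * (x + e) ^ 2 / a₁))
        (nhdsWithin 0 (Set.Ioi 0))
        (nhds (quarterI * (2 / 3 * x ^ 3 - 1 / 3 * x ^ 2 / a₁))) := by
      have : Continuous (fun e : ℝ =>
        quarterI * (2 / 3 * (x + e) ^ 3 - 1 / 3 * (x + e) ^ 2 / a₁)) := by fun_prop
      have h := this.tendsto 0
      simp only [add_zero] at h
      exact h.mono_left nhdsWithin_le_nhds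
    refine le_of_tendsto_of_tendsto c1 c2 ?_
    filter_upwards [Ioo_mem_nhdsGT hxpos] with e he
    exact main e he.1 he.2
  have h17 : 17 ≤ 1 / a₁ := by
    rw [le_div_iff₀ ha]
    exact hshort.le
  have e1 : 1 / 3 * x ^ 2 / a₁ = 1 / 3 * x ^ 2 * (1 / a₁) := by ring
  rw [e1] at lim
  have hI := quarterI_ge
  have hx2 : 0 < x ^ 2 := by positivity
  have h3 : 1 / 3 * x ^ 2 * 17 ≤ 1 / 3 * x ^ 2 * (1 / a₁) := by gcongr
  have h4 := mul_le_mul_of_nonneg_left h3 (by linarith : 0 ≤ quarterI)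
  have h5 := mul_le_mul_of_nonneg_right hI hx2.le
  nlinarith
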